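/- arXiv:1802.06844 — 2 statements merged into one kernel-verified Lean document; each statement's English description precedes it below -/
import Mathlib

section
/- Let T_a and T_b be theories with T_a ⋈ T_b. Then: (1) if T_b' is a disjoint renaming of T_b whose signature Σ_b' is disjoint from Σ_a, then T_a ⋈ T_b'; and (2) if T_a' is a disjoint renaming of T_a, T_b' is a disjoint renaming of T_b, and Σ_a' is disjoint from Σ_b', then T_a' ⋈ T_b'. -/
/-!
Formalization framework: first-order logic with equality over purely relational
signatures. A signature is a set `S : Set P` of predicate symbols, where each
symbol `p : P` has arity `ar p`. `Lang ar S` is the corresponding first-order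
language, a theory is a set of sentences of that language, and `STheory`
bundles a theory with its signature.
-/

open FirstOrder Language

namespace DefEqPaper

variable {P : Type} {ar : P → ℕ}

/-- The first-order language (purely relational) of the signature `S`. -/
def Lang (ar : P → ℕ) (S : Set P) : FirstOrder.Language where
  Functions _ := Empty
  Relations n := {p : P // p ∈ S ∧ ar p = n}

/-- A theory together with its signature. -/
structure STheory (P : Type) (ar : P → ℕ) where
  sig : Set P
  th : (Lang ar sig).Theory

/-- The inclusion of languages induced by an inclusion of signatures. -/
def langIncl {S S' : Set P} (h : S ⊆ S') : Lang ar S →ᴸ Lang ar S' where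
  onFunction _ f := f.elim
  onRelation _ r := ⟨r.1, h r.2.1, r.2.2⟩

/-- Logical equivalence: two theories of the same language having the same class
of models. -/
def TheoryEquiv {L : FirstOrder.Language} (T T' : L.Theory) : Prop :=
  ∀ (M : Type) [L.Structure M] [Nonempty M], (M ⊨ T ↔ M ⊨ T')

/-- The explicit definition `∀ x₁ … xₙ (p(x₁,…,xₙ) ↔ φ(x₁,…,xₙ))` of a relation
symbol `p ∈ S'` by a formula `φ` of the language of `S`, as a sentence of the
language of `S'`. -/
def explicitDef {S S' : Set P} (h : S ⊆ S') {p : P} (hp : p ∈ S')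
    (φ : (Lang ar S).Formula (Fin (ar p))) : (Lang ar S').Sentence :=
  (BoundedFormula.iff
    (Relations.boundedFormula (⟨p, hp, rfl⟩ : (Lang ar S').Relations (ar p))
      (fun i => Term.var (Sum.inr i)))
    (BoundedFormula.relabel Sum.inr ((langIncl h).onFormula φ))).alls

/-- `Δ` is a set consisting of one explicit definition, in terms of the language
of `S`, for each relation symbol of `S' \ S`. -/
def IsDefinitionSet {S S' : Set P} (h : S ⊆ S') (Δ : Set ((Lang ar S').Sentence)) : Prop :=
  ∃ d : (p : P) → p ∈ S' → p ∉ S → (Lang ar S).Formula (Fin (ar p)),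
    Δ = {σ | ∃ (p : P) (hp : p ∈ S') (hn : p ∉ S), σ = explicitDef h hp (d p hp hn)}

/-- `T'` is a definitional extension of `T`: the signature of `T'` contains that of
`T` and `T'` is logically equivalent to `T ∪ Δ` for a set `Δ` of explicit
definitions, in terms of the language of `T`, of the new relation symbols. -/
def DefExt (T T' : STheory P ar) : Prop :=
  ∃ h : T.sig ⊆ T'.sig, ∃ Δ : Set ((Lang ar T'.sig).Sentence),
    IsDefinitionSet h Δ ∧ TheoryEquiv ((langIncl h).onTheory T.th ∪ Δ) T'.th

/-- `T₁` and `T₂` are definitionally mergeable (Barrett–Halvorson): they have a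
common definitional extension. -/
def Mergeable (T₁ T₂ : STheory P ar) : Prop :=
  ∃ T' : STheory P ar, DefExt T₁ T' ∧ DefExt T₂ T'

/-- Definitional equivalence (Andréka–Németi): there is a finite chain of theories
connecting `T` and `T'` in which each consecutive pair is related by definitional
extension in one direction or the other. -/
def DefEquiv : STheory P ar → STheory P ar → Prop :=
  Relation.ReflTransGen (fun T T' => DefExt T T' ∨ DefExt T' T)

/-- Renaming of signatures along an arity-preserving map, as a map of languages. -/
def renameLHom {S S' : Set P} (ρ : P → P) (hmap : Set.MapsTo ρ S S')
    (har : ∀ p ∈ S, ar (ρ p) = ar p) : Lang ar S →ᴸ Lang ar S' where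
  onFunction _ f := f.elim
  onRelation _ r := ⟨ρ r.1, hmap r.2.1, (har r.1 r.2.1).trans r.2.2⟩

/-- `T'` is a disjoint renaming of `T`: their signatures are disjoint and there is
an arity-preserving bijection between the signatures under which the sentences of
`T'` are exactly the renamings of the sentences of `T`. -/
def IsDisjointRenaming (T T' : STheory P ar) : Prop :=
  Disjoint T.sig T'.sig ∧
    ∃ (ρ : P → P) (hbij : Set.BijOn ρ T.sig T'.sig)
      (har : ∀ p ∈ T.sig, ar (ρ p) = ar p),
      T'.th = (renameLHom ρ hbij.mapsTo har).onTheory T.th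

/-- The variable of a term of a purely relational language. -/
def termVar {S : Set P} {β : Type} : (Lang ar S).Term β → β
  | .var v => v
  | .func f _ => f.elim

/-- The translation of formulas induced by a map `t` sending each `n`-ary relation
symbol of the language of `S₁` to a formula of the language of `S₂` with (at most)
`n` free variables.  It maps `p(x₁,…,xₙ)` to `(t p)(x₁,…,xₙ)` and commutes with
equality and all connectives and quantifiers. -/
def trBF {S₁ S₂ : Set P} (t : ∀ n, (Lang ar S₁).Relations n → (Lang ar S₂).Formula (Fin n)) :
    ∀ {α : Type} {n : ℕ}, (Lang ar S₁).BoundedFormula α n → (Lang ar S₂).BoundedFormula α n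
  | _, _, .falsum => .falsum
  | _, _, .equal t₁ t₂ => .equal (.var (termVar t₁)) (.var (termVar t₂))
  | _, _, .rel R ts => BoundedFormula.relabel (fun i => termVar (ts i)) (t _ R)
  | _, _, .imp f g => (trBF t f).imp (trBF t g)
  | _, _, .all f => (trBF t f).all

/-- `φ` is a semantic consequence of the theory `T`. -/
def Conseq {L : FirstOrder.Language} (T : L.Theory) (φ : L.Sentence) : Prop :=
  ∀ (M : Type) [L.Structure M] [Nonempty M], M ⊨ T → M ⊨ φ

/-- The map `t` on relation symbols induces a translation of the theory `T₁` to the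
theory `T₂`: it maps consequences of `T₁` to consequences of `T₂`. -/
def IsTranslation (T₁ T₂ : STheory P ar)
    (t : ∀ n, (Lang ar T₁.sig).Relations n → (Lang ar T₂.sig).Formula (Fin n)) : Prop :=
  ∀ φ : (Lang ar T₁.sig).Sentence, Conseq T₁.th φ → Conseq T₂.th (trBF t φ)

/-- `T₁` and `T₂` are intertranslatable: there are translations `t₁₂` of `T₁` to `T₂`
and `t₂₁` of `T₂` to `T₁` such that
`T₁ ⊨ ∀ x̄ (φ(x̄) ↔ tr₂₁(tr₁₂(φ(x̄))))` for every formula `φ` of the language of `T₁`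
and `T₂ ⊨ ∀ x̄ (ψ(x̄) ↔ tr₁₂(tr₂₁(ψ(x̄))))` for every formula `ψ` of the language of `T₂`. -/
def Intertranslatable (T₁ T₂ : STheory P ar) : Prop :=
  ∃ (t₁₂ : ∀ n, (Lang ar T₁.sig).Relations n → (Lang ar T₂.sig).Formula (Fin n))
    (t₂₁ : ∀ n, (Lang ar T₂.sig).Relations n → (Lang ar T₁.sig).Formula (Fin n)),
    IsTranslation T₁ T₂ t₁₂ ∧ IsTranslation T₂ T₁ t₂₁ ∧
    (∀ (n : ℕ) (φ : (Lang ar T₁.sig).BoundedFormula Empty n),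
      Conseq T₁.th ((φ.iff (trBF t₂₁ (trBF t₁₂ φ))).alls)) ∧
    (∀ (n : ℕ) (ψ : (Lang ar T₂.sig).BoundedFormula Empty n),
      Conseq T₂.th ((ψ.iff (trBF t₁₂ (trBF t₂₁ ψ))).alls))

/-- The structure `tr*(𝔐)` induced on the underlying set of a structure `𝔐` for the
language of `S₂` by a translation-map `t`: each relation symbol `R` is interpreted by
the relation defined by the formula `t R` in `𝔐`. -/
def trStruc {S₁ S₂ : Set P} (t : ∀ n, (Lang ar S₁).Relations n → (Lang ar S₂).Formula (Fin n))
    (M : Type) (inst : (Lang ar S₂).Structure M) : (Lang ar S₁).Structure M where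
  funMap f _ := f.elim
  RelMap {n} R x := letI := inst; (t n R).Realize x

end DefEqPaper

namespace DefEqPaper

/-- The structure on `M` interpreting the symbols of `S` as prescribed by `I`. -/
def struc {M : Type} (ar : P → ℕ) (S : Set P) (I : P → ∀ n, (Fin n → M) → Prop) :
    (Lang ar S).Structure M where
  funMap f _ := f.elim
  RelMap {n} R x := I R.1 n x

/-- The theory `T` holds under the interpretation `I`. -/
def Sat {M : Type} {S : Set P} (I : P → ∀ n, (Fin n → M) → Prop) (T : (Lang ar S).Theory) :
    Prop :=
  letI := struc ar S I
  M ⊨ T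

/-- The formula `φ` holds of `x` under the interpretation `I`. -/
def Holds {M : Type} {S : Set P} {α : Type} (I : P → ∀ n, (Fin n → M) → Prop)
    (φ : (Lang ar S).Formula α) (x : α → M) : Prop :=
  letI := struc ar S I
  φ.Realize x

variable {M : Type} {S S' : Set P}

theorem exists_eq_struc (inst : (Lang ar S).Structure M) : ∃ I, inst = struc ar S I := by
  refine ⟨fun p n x => ∃ h : p ∈ S ∧ ar p = n,
    inst.RelMap (⟨p, h⟩ : (Lang ar S).Relations n) x, ?_⟩
  apply Structure.ext
  · funext n f
    exact f.elim
  · funext n R x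
    exact propext ⟨fun h => ⟨R.2, h⟩, fun ⟨_, h⟩ => h⟩

theorem struc_congr {I J : P → ∀ n, (Fin n → M) → Prop}
    (h : ∀ p ∈ S, I p (ar p) = J p (ar p)) : struc ar S I = struc ar S J := by
  apply Structure.ext
  · funext n f
    exact f.elim
  · funext n ⟨p, hp, hn⟩ x
    subst hn
    exact congrFun (h p hp) x

theorem sat_congr {I J : P → ∀ n, (Fin n → M) → Prop}
    (h : ∀ p ∈ S, ∀ x, I p (ar p) x ↔ J p (ar p) x) (T : (Lang ar S).Theory) :
    Sat I T ↔ Sat J T := by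
  rw [Sat, Sat, struc_congr fun p hp => funext fun x => propext (h p hp x)]

theorem holds_congr {I J : P → ∀ n, (Fin n → M) → Prop}
    (h : ∀ p ∈ S, ∀ x, I p (ar p) x ↔ J p (ar p) x) {α : Type} (φ : (Lang ar S).Formula α)
    (x : α → M) : Holds I φ x ↔ Holds J φ x := by
  rw [Holds, Holds, struc_congr fun p hp => funext fun x => propext (h p hp x)]

theorem theoryEquiv_iff {T T' : (Lang ar S).Theory} :
    TheoryEquiv T T' ↔
      ∀ (M : Type) [Nonempty M] (I : P → ∀ n, (Fin n → M) → Prop), Sat I T ↔ Sat I T' := by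
  refine ⟨fun h M _ I => @h M (struc ar S I) _, fun h M inst _ => ?_⟩
  obtain ⟨I, rfl⟩ := exists_eq_struc inst
  exact h M I

theorem sat_langIncl (h : S ⊆ S') (I : P → ∀ n, (Fin n → M) → Prop) (T : (Lang ar S).Theory) :
    Sat I ((langIncl h).onTheory T) ↔ Sat I T := by
  let := struc ar S I
  let := struc ar S' I
  have : (langIncl (ar := ar) h).IsExpansionOn M :=
    ⟨fun f _ => f.elim, fun _ _ => rfl⟩
  exact LHom.onTheory_model _ T

theorem holds_langIncl (h : S ⊆ S') (I : P → ∀ n, (Fin n → M) → Prop) {α : Type}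
    (φ : (Lang ar S).Formula α) (x : α → M) :
    Holds I ((langIncl h).onFormula φ) x ↔ Holds I φ x := by
  let := struc ar S I
  let := struc ar S' I
  have : (langIncl (ar := ar) h).IsExpansionOn M :=
    ⟨fun f _ => f.elim, fun _ _ => rfl⟩
  exact LHom.realize_onFormula _ φ

theorem sat_renameLHom (ρ : P → P) (hmap : Set.MapsTo ρ S S') (har : ∀ p ∈ S, ar (ρ p) = ar p)
    (I : P → ∀ n, (Fin n → M) → Prop) (T : (Lang ar S).Theory) :
    Sat I ((renameLHom ρ hmap har).onTheory T) ↔ Sat (fun p => I (ρ p)) T := by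
  let := struc ar S fun p => I (ρ p)
  let := struc ar S' I
  have : (renameLHom ρ hmap har).IsExpansionOn M :=
    ⟨fun f _ => f.elim, fun _ _ => rfl⟩
  exact LHom.onTheory_model _ T

theorem holds_renameLHom (ρ : P → P) (hmap : Set.MapsTo ρ S S')
    (har : ∀ p ∈ S, ar (ρ p) = ar p) (I : P → ∀ n, (Fin n → M) → Prop) {α : Type}
    (φ : (Lang ar S).Formula α) (x : α → M) :
    Holds I ((renameLHom ρ hmap har).onFormula φ) x ↔ Holds (fun p => I (ρ p)) φ x := by
  let := struc ar S fun p => I (ρ p)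
  let := struc ar S' I
  have : (renameLHom ρ hmap har).IsExpansionOn M :=
    ⟨fun f _ => f.elim, fun _ _ => rfl⟩
  exact LHom.realize_onFormula _ φ

theorem realize_explicitDef (h : S ⊆ S') {p : P} (hp : p ∈ S')
    (φ : (Lang ar S).Formula (Fin (ar p))) (I : P → ∀ n, (Fin n → M) → Prop) :
    (letI := struc ar S' I; M ⊨ explicitDef h hp φ) ↔ ∀ x, I p (ar p) x ↔ Holds I φ x := by
  let := struc ar S' I
  refine BoundedFormula.realize_alls.trans (forall_congr' fun x => ?_)
  rw [← holds_langIncl h]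
  refine BoundedFormula.realize_iff.trans (iff_congr Iff.rfl ?_)
  exact Formula.realize_relabel_sumInr _

/-- Each symbol of `T'` is defined by `d` in terms of `T`, and `T'` holds exactly when `T` and
these definitions hold. -/
structure IsDefinedBy (T T' : STheory P ar)
    (d : P → ∀ n, (Lang ar T.sig).Formula (Fin n)) : Prop where
  holds_self {M : Type} (I : P → ∀ n, (Fin n → M) → Prop) :
    ∀ p ∈ T.sig, ∀ x, Holds I (d p (ar p)) x ↔ I p (ar p) x
  sat_iff {M : Type} [Nonempty M] (I : P → ∀ n, (Fin n → M) → Prop) :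
    Sat I T'.th ↔ Sat I T.th ∧ ∀ p ∈ T'.sig, ∀ x, I p (ar p) x ↔ Holds I (d p (ar p)) x

theorem sat_union_iff (h : S ⊆ S') (T : (Lang ar S).Theory)
    (d : (p : P) → p ∈ S' → p ∉ S → (Lang ar S).Formula (Fin (ar p)))
    (I : P → ∀ n, (Fin n → M) → Prop) :
    Sat I ((langIncl h).onTheory T ∪ {σ | ∃ (p : P) (hp : p ∈ S') (hn : p ∉ S),
        σ = explicitDef h hp (d p hp hn)}) ↔
      Sat I T ∧ ∀ p hp hn x, I p (ar p) x ↔ Holds I (d p hp hn) x := by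
  rw [← sat_langIncl h]
  let := struc ar S' I
  refine Theory.model_union_iff.trans (and_congr Iff.rfl ((Theory.model_iff _).trans
    ⟨fun H p hp hn => (realize_explicitDef h hp _ I).1 (H _ ⟨p, hp, hn, rfl⟩), ?_⟩))
  rintro H _ ⟨p, hp, hn, rfl⟩
  exact (realize_explicitDef h hp _ I).2 (H p hp hn)

open Classical in
theorem DefExt.exists_isDefinedBy {T T' : STheory P ar} (hT : DefExt T T') :
    T.sig ⊆ T'.sig ∧ ∃ d, IsDefinedBy T T' d := by
  obtain ⟨h, _, ⟨d, rfl⟩, hequiv⟩ := hT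
  rw [theoryEquiv_iff] at hequiv
  have key : ∀ p, ∃ φ : ∀ n, (Lang ar T.sig).Formula (Fin n),
      (p ∈ T.sig → ∀ {M : Type} (I : P → ∀ n, (Fin n → M) → Prop) x,
        Holds I (φ (ar p)) x ↔ I p (ar p) x) ∧
      ∀ hp hn, φ (ar p) = d p hp hn := by
    intro p
    suffices ∃ φ : (Lang ar T.sig).Formula (Fin (ar p)),
        (p ∈ T.sig → ∀ {M : Type} (I : P → ∀ n, (Fin n → M) → Prop) x,
          Holds I φ x ↔ I p (ar p) x) ∧ ∀ hp hn, φ = d p hp hn by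
      obtain ⟨φ, hφ⟩ := this
      refine ⟨fun n => if e : ar p = n then e ▸ φ else ⊥, ?_⟩
      simpa using hφ
    by_cases hn : p ∈ T.sig
    · exact ⟨Relations.formula (⟨p, hn, rfl⟩ : (Lang ar T.sig).Relations (ar p)) Term.var,
        fun _ _ _ _ => Iff.rfl, fun _ hn' => absurd hn hn'⟩
    by_cases hp : p ∈ T'.sig
    · exact ⟨d p hp hn, fun h' => absurd h' hn, fun _ _ => rfl⟩
    · exact ⟨⊥, fun h' => absurd h' hn, fun hp' => absurd hp' hp⟩
  choose φ hself hφ using key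
  refine ⟨h, φ, fun I p hp => hself p hp I, fun I => ?_⟩
  rw [← hequiv, sat_union_iff]
  refine and_congr Iff.rfl ⟨fun H p hp x => ?_, fun H p hp hn x => ?_⟩
  · by_cases hn : p ∈ T.sig
    · exact (hself p hn I x).symm
    · rw [hφ p hp hn]
      exact H p hp hn x
  · rw [← hφ p hp hn]
    exact H p hp x

/-- Passing from models of `Ta` to models of `Tb` along a common definitional extension, the
interpretation of the two signatures being read off from `I` through `ρa` and `ρb`. -/
theorem IsDefinedBy.sat_of_sat {Ta Tb T' : STheory P ar} {da db} (ha : Ta.sig ⊆ T'.sig)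
    (hda : IsDefinedBy Ta T' da) (hdb : IsDefinedBy Tb T' db)
    [Nonempty M] {Ia Ib : P → ∀ n, (Fin n → M) → Prop} (hsat : Sat Ia Ta.th)
    (hdef : ∀ q ∈ Tb.sig, ∀ x, Ib q (ar q) x ↔ Holds Ia (da q (ar q)) x) :
    Sat Ib Tb.th ∧ ∀ p ∈ Ta.sig, ∀ x, Ia p (ar p) x ↔ Holds Ib (db p (ar p)) x := by
  let N : P → ∀ n, (Fin n → M) → Prop := fun p n x => Holds Ia (da p n) x
  have hNa : ∀ p ∈ Ta.sig, ∀ x, N p (ar p) x ↔ Ia p (ar p) x := hda.holds_self Ia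
  have hNb : ∀ q ∈ Tb.sig, ∀ x, N q (ar q) x ↔ Ib q (ar q) x :=
    fun q hq x => (hdef q hq x).symm
  have hN : Sat N T'.th :=
    (hda.sat_iff N).2 ⟨(sat_congr hNa _).2 hsat, fun p _ x => (holds_congr hNa _ x).symm⟩
  obtain ⟨hsat_b, hdef_b⟩ := (hdb.sat_iff N).1 hN
  exact ⟨(sat_congr hNb _).1 hsat_b, fun p hp x =>
    (hNa p hp x).symm.trans ((hdef_b p (ha hp) x).trans (holds_congr hNb _ x))⟩

/-- The explicit definitions, over a renamed copy of `A`, of a renamed copy of the symbols of `B`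
that are defined over `A` by `d`. -/
def renamedDefs {A A' : Set P} (ρ σ : P → P) (hmap : Set.MapsTo ρ A A')
    (har : ∀ p ∈ A, ar (ρ p) = ar p) (d : P → ∀ n, (Lang ar A).Formula (Fin n)) (p : P) :
    (Lang ar A').Formula (Fin (ar p)) :=
  (renameLHom ρ hmap har).onFormula (d (σ p) (ar p))

theorem forall_renamedDefs_iff {A A' B B' : Set P} {ρa ρb σ : P → P}
    (hρa : Set.MapsTo ρa A A') (hρb : Set.BijOn ρb B B') (hσ : ∀ q ∈ B, σ (ρb q) = q)
    (hara : ∀ p ∈ A, ar (ρa p) = ar p) (harb : ∀ p ∈ B, ar (ρb p) = ar p)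
    (d : P → ∀ n, (Lang ar A).Formula (Fin n)) (I : P → ∀ n, (Fin n → M) → Prop) :
    (∀ p ∈ B', ∀ x, I p (ar p) x ↔ Holds I (renamedDefs ρa σ hρa hara d p) x) ↔
      ∀ q ∈ B, ∀ x, I (ρb q) (ar q) x ↔ Holds (fun p => I (ρa p)) (d q (ar q)) x := by
  simp only [renamedDefs, holds_renameLHom]
  rw [← hρb.image_eq, Set.forall_mem_image]
  refine forall₂_congr fun q hq => ?_
  rw [hσ q hq, harb q hq]

/-- A theory over the union of disjoint signatures that is axiomatized by a theory over the first
together with definitions of the symbols of the second is a definitional extension. -/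
theorem defExt_of_sat_iff {T Tu : STheory P ar} {B : Set P} (hsig : Tu.sig = T.sig ∪ B)
    (hdisj : Disjoint T.sig B) (d : ∀ p, (Lang ar T.sig).Formula (Fin (ar p)))
    (h : ∀ (M : Type) [Nonempty M] (I : P → ∀ n, (Fin n → M) → Prop),
      Sat I Tu.th ↔ Sat I T.th ∧ ∀ p ∈ B, ∀ x, I p (ar p) x ↔ Holds I (d p) x) :
    DefExt T Tu := by
  refine ⟨hsig ▸ Set.subset_union_left, _, ⟨fun p _ _ => d p, rfl⟩, theoryEquiv_iff.2 ?_⟩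
  intro M _ I
  rw [sat_union_iff, h]
  refine and_congr Iff.rfl ⟨fun H p hp => H p ?_ (hdisj.notMem_of_mem_right hp),
    fun H p hp hn => H p ?_⟩
  · exact hsig ▸ Or.inr hp
  · rw [hsig] at hp
    exact hp.resolve_left hn

theorem exists_leftInvOn {ρ : P → P} (hρ : Set.InjOn ρ S) : ∃ σ : P → P, Set.LeftInvOn σ ρ S := by
  cases isEmpty_or_nonempty P
  · exact ⟨id, fun p => isEmptyElim p⟩
  · exact ⟨_, hρ.leftInvOn_invFunOn⟩

theorem mergeable_of_bijOn {Ta Tb Ta' Tb' : STheory P ar} (hab : Mergeable Ta Tb)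
    {ρa ρb : P → P} (hρa : Set.BijOn ρa Ta.sig Ta'.sig) (hρb : Set.BijOn ρb Tb.sig Tb'.sig)
    (hara : ∀ p ∈ Ta.sig, ar (ρa p) = ar p) (harb : ∀ p ∈ Tb.sig, ar (ρb p) = ar p)
    (htha : Ta'.th = (renameLHom ρa hρa.mapsTo hara).onTheory Ta.th)
    (hthb : Tb'.th = (renameLHom ρb hρb.mapsTo harb).onTheory Tb.th)
    (hdisj : Disjoint Ta'.sig Tb'.sig) : Mergeable Ta' Tb' := by
  obtain ⟨T', hTa, hTb⟩ := hab
  obtain ⟨ha, da, hda⟩ := hTa.exists_isDefinedBy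
  obtain ⟨hb, db, hdb⟩ := hTb.exists_isDefinedBy
  obtain ⟨σa, hσa⟩ := exists_leftInvOn hρa.injOn
  obtain ⟨σb, hσb⟩ := exists_leftInvOn hρb.injOn
  let Da := renamedDefs ρa σb hρa.mapsTo hara da
  let Db := renamedDefs ρb σa hρb.mapsTo harb db
  let hsub : Ta'.sig ⊆ Ta'.sig ∪ Tb'.sig := Set.subset_union_left
  let Tu : STheory P ar := ⟨Ta'.sig ∪ Tb'.sig, (langIncl hsub).onTheory Ta'.th ∪
    {σ | ∃ (p : P) (hp : p ∈ Ta'.sig ∪ Tb'.sig) (_ : p ∉ Ta'.sig), σ = explicitDef hsub hp (Da p)}⟩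
  have hT (M : Type) (I : P → ∀ n, (Fin n → M) → Prop) : Sat I Tu.th ↔
      Sat I Ta'.th ∧ ∀ p ∈ Tb'.sig, ∀ x, I p (ar p) x ↔ Holds I (Da p) x := by
    rw [sat_union_iff hsub Ta'.th (fun p _ _ => Da p)]
    exact and_congr Iff.rfl
      ⟨fun H p hp => H p (Or.inr hp) (hdisj.notMem_of_mem_right hp),
        fun H p hp hn => H p (hp.resolve_left hn)⟩
  refine ⟨Tu, defExt_of_sat_iff rfl hdisj Da fun M _ I => hT M I,
    defExt_of_sat_iff (Set.union_comm _ _) hdisj.symm Db fun M _ I => ?_⟩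
  rw [hT, htha, hthb, sat_renameLHom, sat_renameLHom,
    forall_renamedDefs_iff hρa.mapsTo hρb hσb hara harb,
    forall_renamedDefs_iff hρb.mapsTo hρa hσa harb hara]
  exact ⟨fun H => hda.sat_of_sat ha hdb H.1 H.2, fun H => hdb.sat_of_sat hb hda H.1 H.2⟩

/-- Lemma 3: let `T_a ⋈ T_b`.  (1) If `T_b'` is a disjoint renaming of `T_b` whose
signature is disjoint from that of `T_a`, then `T_a ⋈ T_b'`.  (2) If moreover `T_a'`
is a disjoint renaming of `T_a` and the signatures of `T_a'` and `T_b'` are disjoint,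
then `T_a' ⋈ T_b'`. -/
theorem mergeable_of_renaming {P : Type} {ar : P → ℕ} (Ta Tb : STheory P ar)
    (hab : Mergeable Ta Tb) :
    (∀ Tb' : STheory P ar, IsDisjointRenaming Tb Tb' → Disjoint Ta.sig Tb'.sig →
      Mergeable Ta Tb') ∧
    (∀ Ta' Tb' : STheory P ar, IsDisjointRenaming Ta Ta' → IsDisjointRenaming Tb Tb' →
      Disjoint Ta'.sig Tb'.sig → Mergeable Ta' Tb') := by
  constructor
  · rintro Tb' ⟨-, ρb, hρb, harb, hthb⟩ hdisj
    refine mergeable_of_bijOn hab (Set.bijOn_id _) hρb (fun _ _ => rfl) harb ?_ hthb hdisj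
    have hid : renameLHom id (Set.bijOn_id Ta.sig).mapsTo (fun _ _ => rfl) =
        LHom.id (Lang ar Ta.sig) :=
      LHom.funext (funext fun _ => funext fun f => f.elim) rfl
    rw [hid]
    simp [LHom.onTheory, LHom.onSentence, LHom.onFormula]
  · rintro Ta' Tb' ⟨-, ρa, hρa, hara, htha⟩ ⟨-, ρb, hρb, harb, hthb⟩ hdisj
    exact mergeable_of_bijOn hab hρa hρb hara harb htha hthb hdisj

end DefEqPaper
end

section
/- Let T and T' be two theories formulated in languages with disjoint signatures (Σ ∩ Σ' = ∅). Then the following are equivalent: (i) T and T' are definitionally equivalent; (ii) T and T' are definitionally mergeable; (iii) T and T' are intertranslatable. -/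
/-!
Formalization framework: first-order logic with equality over purely relational
signatures. A signature is a set `S : Set P` of predicate symbols, where each
symbol `p : P` has arity `ar p`. `Lang ar S` is the corresponding first-order
language, a theory is a set of sentences of that language, and `STheory`
bundles a theory with its signature.
-/

open FirstOrder Language

namespace DefEqPaper

section Semantics

variable {P : Type} {ar : P → ℕ} {S S₁ S₂ S₃ : Set P}

theorem structure_ext {M : Type} {A B : (Lang ar S).Structure M}
    (h : ∀ (p : P) (hp : p ∈ S) (x : Fin (ar p) → M),
      A.RelMap (⟨p, hp, rfl⟩ : (Lang ar S).Relations (ar p)) x ↔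
        B.RelMap (⟨p, hp, rfl⟩ : (Lang ar S).Relations (ar p)) x) : A = B := by
  apply FirstOrder.Language.Structure.ext
  · funext n f
    exact f.elim
  · funext n R x
    obtain ⟨p, hp, rfl⟩ := R
    exact propext (h p hp x)

theorem realize_termVar {M β : Type} [(Lang ar S).Structure M] (v : β → M)
    (t : (Lang ar S).Term β) : t.realize v = v (termVar t) := by
  cases t with
  | var => rfl
  | func f => exact f.elim

theorem realize_trBF (t : ∀ n, (Lang ar S₁).Relations n → (Lang ar S₂).Formula (Fin n))
    {M : Type} (inst : (Lang ar S₂).Structure M) {α : Type} {n : ℕ}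
    (φ : (Lang ar S₁).BoundedFormula α n) (v : α → M) (xs : Fin n → M) :
    (trBF t φ).Realize v xs ↔ @BoundedFormula.Realize _ M (trStruc t M inst) _ _ φ v xs := by
  let := trStruc t M inst
  induction φ with
  | falsum => simp only [trBF, BoundedFormula.Realize]
  | equal t₁ t₂ =>
    simp only [trBF, BoundedFormula.Realize, realize_termVar]
    rfl
  | rel R ts =>
    simp only [trBF, BoundedFormula.Realize, realize_termVar]
    refine (BoundedFormula.realize_relabel (n := 0)).trans ?_
    refine iff_of_eq (congrArg₂ _ ?_ (Subsingleton.elim _ _))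
    funext i
    exact congrArg (fun f => Sum.elim v f (termVar (ts i))) (funext fun j => rfl)
  | imp f g ihf ihg =>
    simp only [trBF, BoundedFormula.Realize, ihf, ihg]
  | all f ih =>
    simp only [trBF, BoundedFormula.Realize, ih]

theorem models_trBF (t : ∀ n, (Lang ar S₁).Relations n → (Lang ar S₂).Formula (Fin n))
    {M : Type} (inst : (Lang ar S₂).Structure M) (φ : (Lang ar S₁).Sentence) :
    M ⊨ (show (Lang ar S₂).Sentence from trBF t φ) ↔
      @Sentence.Realize _ M (trStruc t M inst) φ :=
  realize_trBF t inst φ _ _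

/-- Composition of maps from relation symbols to formulas. -/
def compTr (t : ∀ n, (Lang ar S₁).Relations n → (Lang ar S₂).Formula (Fin n))
    (u : ∀ n, (Lang ar S₂).Relations n → (Lang ar S₃).Formula (Fin n)) :
    ∀ n, (Lang ar S₁).Relations n → (Lang ar S₃).Formula (Fin n) :=
  fun n R => trBF u (t n R)

theorem trStruc_compTr (t : ∀ n, (Lang ar S₁).Relations n → (Lang ar S₂).Formula (Fin n))
    (u : ∀ n, (Lang ar S₂).Relations n → (Lang ar S₃).Formula (Fin n))
    {M : Type} (inst : (Lang ar S₃).Structure M) :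
    trStruc (compTr t u) M inst = trStruc t M (trStruc u M inst) :=
  structure_ext fun p hp x => realize_trBF u inst (t _ ⟨p, hp, rfl⟩) x default

/-- The reduct of a structure along an inclusion of signatures. -/
abbrev reductStruc (h : S₁ ⊆ S₂) {M : Type} (inst : (Lang ar S₂).Structure M) :
    (Lang ar S₁).Structure M :=
  (langIncl h).reduct M

theorem realize_explicitDef_s9 (h : S₁ ⊆ S₂) {p : P} (hp : p ∈ S₂)
    (φ : (Lang ar S₁).Formula (Fin (ar p))) {M : Type} (inst : (Lang ar S₂).Structure M) :
    M ⊨ explicitDef h hp φ ↔ ∀ x : Fin (ar p) → M,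
      (inst.RelMap (⟨p, hp, rfl⟩ : (Lang ar S₂).Relations (ar p)) x ↔
        @Formula.Realize _ M (reductStruc h inst) _ φ x) := by
  let := reductStruc h inst
  refine BoundedFormula.realize_alls.trans (forall_congr' fun x => ?_)
  rw [BoundedFormula.realize_iff]
  refine iff_congr (BoundedFormula.realize_rel) ?_
  refine (BoundedFormula.realize_relabel (n := 0)).trans ?_
  rw [← LHom.realize_onFormula (langIncl h) φ]
  exact iff_of_eq (congrArg₂ _ (funext fun _ => rfl) (Subsingleton.elim _ _))

theorem models_definitions (h : S₁ ⊆ S₂)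
    (d : (p : P) → p ∈ S₂ → p ∉ S₁ → (Lang ar S₁).Formula (Fin (ar p)))
    (T : (Lang ar S₁).Theory) {M : Type} (inst : (Lang ar S₂).Structure M) :
    M ⊨ (langIncl h).onTheory T ∪
        {σ | ∃ (p : P) (hp : p ∈ S₂) (hn : p ∉ S₁), σ = explicitDef h hp (d p hp hn)} ↔
      @Theory.Model _ M (reductStruc h inst) T ∧
        ∀ (p : P) (hp : p ∈ S₂) (hn : p ∉ S₁) (x : Fin (ar p) → M),
          (inst.RelMap (⟨p, hp, rfl⟩ : (Lang ar S₂).Relations (ar p)) x ↔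
            @Formula.Realize _ M (reductStruc h inst) _ (d p hp hn) x) := by
  let := reductStruc h inst
  rw [Theory.model_union_iff, LHom.onTheory_model]
  refine and_congr Iff.rfl ?_
  rw [Theory.model_iff]
  constructor
  · intro H p hp hn
    exact (realize_explicitDef_s9 h hp _ inst).1 (H _ ⟨p, hp, hn, rfl⟩)
  · rintro H _ ⟨p, hp, hn, rfl⟩
    exact (realize_explicitDef_s9 h hp _ inst).2 (H p hp hn)

/-- A semantic form of definitional extension. -/
theorem defExt_iff {T T' : STheory P ar} : DefExt T T' ↔ ∃ (h : T.sig ⊆ T'.sig)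
    (d : (p : P) → p ∈ T'.sig → p ∉ T.sig → (Lang ar T.sig).Formula (Fin (ar p))),
    ∀ (M : Type) (inst : (Lang ar T'.sig).Structure M) [Nonempty M],
      (M ⊨ T'.th ↔ @Theory.Model _ M (reductStruc h inst) T.th ∧
        ∀ (p : P) (hp : p ∈ T'.sig) (hn : p ∉ T.sig) (x : Fin (ar p) → M),
          (inst.RelMap (⟨p, hp, rfl⟩ : (Lang ar T'.sig).Relations (ar p)) x ↔
            @Formula.Realize _ M (reductStruc h inst) _ (d p hp hn) x)) := by
  constructor
  · rintro ⟨h, _, ⟨d, rfl⟩, H⟩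
    exact ⟨h, d, fun M inst _ => (H M).symm.trans (models_definitions h d T.th inst)⟩
  · rintro ⟨h, d, H⟩
    exact ⟨h, _, ⟨d, rfl⟩, fun M inst _ =>
      (models_definitions h d T.th inst).trans (H M inst).symm⟩

/-- `t` pulls models of `T₂` back to models of `T₁`. -/
def PullsBack (T₁ T₂ : STheory P ar)
    (t : ∀ n, (Lang ar T₁.sig).Relations n → (Lang ar T₂.sig).Formula (Fin n)) : Prop :=
  ∀ (M : Type) (inst : (Lang ar T₂.sig).Structure M) [Nonempty M], M ⊨ T₂.th →
    @Theory.Model _ M (trStruc t M inst) T₁.th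

/-- On models of `T`, pulling back along `u` and then along `t` is the identity. -/
def RetractsOn (T : STheory P ar)
    (t : ∀ n, (Lang ar T.sig).Relations n → (Lang ar S).Formula (Fin n))
    (u : ∀ n, (Lang ar S).Relations n → (Lang ar T.sig).Formula (Fin n)) : Prop :=
  ∀ (M : Type) (inst : (Lang ar T.sig).Structure M) [Nonempty M], M ⊨ T.th →
    trStruc t M (trStruc u M inst) = inst

/-- Two theories are semantically equivalent if their classes of models correspond
bijectively under pulling back along maps from relation symbols to formulas. -/
def SemEquiv (T₁ T₂ : STheory P ar) : Prop :=
  ∃ (t : ∀ n, (Lang ar T₁.sig).Relations n → (Lang ar T₂.sig).Formula (Fin n))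
    (u : ∀ n, (Lang ar T₂.sig).Relations n → (Lang ar T₁.sig).Formula (Fin n)),
    PullsBack T₁ T₂ t ∧ PullsBack T₂ T₁ u ∧ RetractsOn T₁ t u ∧ RetractsOn T₂ u t

theorem isTranslation_iff_pullsBack {T₁ T₂ : STheory P ar}
    {t : ∀ n, (Lang ar T₁.sig).Relations n → (Lang ar T₂.sig).Formula (Fin n)} :
    IsTranslation T₁ T₂ t ↔ PullsBack T₁ T₂ t := by
  constructor
  · intro H M inst _ hM
    let := trStruc t M inst
    refine (Theory.model_iff _).2 fun φ hφ => ?_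
    exact (models_trBF t inst φ).1
      (H φ (fun N _ _ hN => (Theory.model_iff _).1 hN φ hφ) M hM)
  · intro H φ hφ M inst _ hM
    exact (models_trBF t inst φ).2 (@hφ M (trStruc t M inst) _ (H M inst hM))

theorem conseq_iff_trBF_iff_retractsOn {T : STheory P ar}
    {t : ∀ n, (Lang ar T.sig).Relations n → (Lang ar S).Formula (Fin n)}
    {u : ∀ n, (Lang ar S).Relations n → (Lang ar T.sig).Formula (Fin n)} :
    (∀ (n : ℕ) (φ : (Lang ar T.sig).BoundedFormula Empty n),
      Conseq T.th ((φ.iff (trBF u (trBF t φ))).alls)) ↔ RetractsOn T t u := by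
  constructor
  · intro H M inst _ hM
    refine structure_ext fun p hp x => ?_
    have h := BoundedFormula.realize_alls.1 (H (ar p)
      (Relations.boundedFormula (⟨p, hp, rfl⟩ : (Lang ar T.sig).Relations (ar p))
        fun i => Term.var (Sum.inr i)) M hM) x
    rw [BoundedFormula.realize_iff, realize_trBF, realize_trBF] at h
    exact h.symm
  · intro H n φ M inst _ hM
    refine BoundedFormula.realize_alls.2 fun x => ?_
    rw [BoundedFormula.realize_iff, realize_trBF, realize_trBF, H M inst hM]

theorem intertranslatable_iff_semEquiv {T₁ T₂ : STheory P ar} :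
    Intertranslatable T₁ T₂ ↔ SemEquiv T₁ T₂ := by
  simp only [Intertranslatable, SemEquiv, isTranslation_iff_pullsBack,
    conseq_iff_trBF_iff_retractsOn]

namespace SemEquiv

theorem symm {T₁ T₂ : STheory P ar} : SemEquiv T₁ T₂ → SemEquiv T₂ T₁ := by
  rintro ⟨t, u, ht, hu, htu, hut⟩
  exact ⟨u, t, hu, ht, hut, htu⟩

theorem trans {T₁ T₂ T₃ : STheory P ar} :
    SemEquiv T₁ T₂ → SemEquiv T₂ T₃ → SemEquiv T₁ T₃ := by
  rintro ⟨t, u, ht, hu, htu, hut⟩ ⟨t', u', ht', hu', htu', hut'⟩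
  refine ⟨compTr t t', compTr u' u, ?_, ?_, ?_, ?_⟩
  · intro M inst _ hM
    rw [trStruc_compTr]
    exact ht M _ (ht' M inst hM)
  · intro M inst _ hM
    rw [trStruc_compTr]
    exact hu' M _ (hu M inst hM)
  · intro M inst _ hM
    rw [trStruc_compTr, trStruc_compTr, htu' M _ (hu M inst hM), htu M inst hM]
  · intro M inst _ hM
    rw [trStruc_compTr, trStruc_compTr, hut M _ (ht' M inst hM), hut' M inst hM]

end SemEquiv

/-- The map sending each relation symbol to the corresponding atomic formula of a larger
signature. -/
def inclTr (h : S₁ ⊆ S₂) : ∀ n, (Lang ar S₁).Relations n → (Lang ar S₂).Formula (Fin n) :=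
  fun _ R => Relations.formula ((langIncl h).onRelation R) Term.var

theorem trStruc_inclTr (h : S₁ ⊆ S₂) {M : Type} (inst : (Lang ar S₂).Structure M) :
    trStruc (inclTr h) M inst = reductStruc h inst :=
  structure_ext fun _ _ _ => Formula.realize_rel

theorem SemEquiv.refl (T : STheory P ar) : SemEquiv T T := by
  have H (M : Type) (inst : (Lang ar T.sig).Structure M) :
      trStruc (inclTr subset_rfl) M inst = inst :=
    (trStruc_inclTr subset_rfl inst).trans (structure_ext fun _ _ _ => Iff.rfl)
  refine ⟨inclTr subset_rfl, inclTr subset_rfl, ?_, ?_, ?_, ?_⟩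
  · intro M inst _ hM
    rwa [H]
  · intro M inst _ hM
    rwa [H]
  · intro M inst _ _
    rw [H, H]
  · intro M inst _ _
    rw [H, H]

open Classical in
/-- The map sending old relation symbols to atomic formulas and new relation symbols to their
definitions. -/
noncomputable def definitionTr
    (d : (p : P) → p ∈ S₂ → p ∉ S₁ → (Lang ar S₁).Formula (Fin (ar p))) :
    ∀ n, (Lang ar S₂).Relations n → (Lang ar S₁).Formula (Fin n) :=
  fun _ R => if hR : R.1 ∈ S₁ then
    Relations.formula (⟨R.1, hR, R.2.2⟩ : (Lang ar S₁).Relations _) Term.var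
  else R.2.2 ▸ d R.1 R.2.1 hR

theorem trStruc_definitionTr_of_mem
    (d : (p : P) → p ∈ S₂ → p ∉ S₁ → (Lang ar S₁).Formula (Fin (ar p)))
    {M : Type} (inst : (Lang ar S₁).Structure M) {p : P} (hp : p ∈ S₂) (hn : p ∈ S₁)
    (x : Fin (ar p) → M) :
    (trStruc (definitionTr d) M inst).RelMap (⟨p, hp, rfl⟩ : (Lang ar S₂).Relations (ar p)) x ↔
      inst.RelMap (⟨p, hn, rfl⟩ : (Lang ar S₁).Relations (ar p)) x := by
  have e : definitionTr d (ar p) ⟨p, hp, rfl⟩ =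
      Relations.formula (⟨p, hn, rfl⟩ : (Lang ar S₁).Relations (ar p)) Term.var := dif_pos hn
  change (definitionTr d (ar p) ⟨p, hp, rfl⟩).Realize x ↔ _
  rw [e]
  exact Formula.realize_rel

theorem trStruc_definitionTr_of_notMem
    (d : (p : P) → p ∈ S₂ → p ∉ S₁ → (Lang ar S₁).Formula (Fin (ar p)))
    {M : Type} (inst : (Lang ar S₁).Structure M) {p : P} (hp : p ∈ S₂) (hn : p ∉ S₁)
    (x : Fin (ar p) → M) :
    (trStruc (definitionTr d) M inst).RelMap (⟨p, hp, rfl⟩ : (Lang ar S₂).Relations (ar p)) x ↔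
      (d p hp hn).Realize x := by
  have e : definitionTr d (ar p) ⟨p, hp, rfl⟩ = d p hp hn := dif_neg hn
  change (definitionTr d (ar p) ⟨p, hp, rfl⟩).Realize x ↔ _
  rw [e]

theorem DefExt.semEquiv {T T' : STheory P ar} (hT : DefExt T T') : SemEquiv T T' := by
  obtain ⟨h, d, H⟩ := defExt_iff.1 hT
  have hred (M : Type) (inst : (Lang ar T.sig).Structure M) :
      reductStruc h (trStruc (definitionTr d) M inst) = inst :=
    structure_ext fun p hp x => trStruc_definitionTr_of_mem d inst (h hp) hp x
  refine ⟨inclTr h, definitionTr d, ?_, ?_, ?_, ?_⟩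
  · intro M inst _ hM
    rw [trStruc_inclTr]
    exact ((H M inst).1 hM).1
  · intro M inst _ hM
    refine (H M _).2 ?_
    rw [hred]
    exact ⟨hM, fun p hp hn x => trStruc_definitionTr_of_notMem d inst hp hn x⟩
  · intro M inst _ hM
    rw [trStruc_inclTr, hred]
  · intro M inst _ hM
    rw [trStruc_inclTr]
    refine structure_ext fun p hp x => ?_
    by_cases hn : p ∈ T.sig
    · exact trStruc_definitionTr_of_mem d _ hp hn x
    · exact (trStruc_definitionTr_of_notMem d _ hp hn x).trans
        (((H M inst).1 hM).2 p hp hn x).symm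

theorem DefEquiv.semEquiv {T T' : STheory P ar} (hT : DefEquiv T T') : SemEquiv T T' := by
  induction hT with
  | refl => exact SemEquiv.refl T
  | tail _ h ih => exact ih.trans (h.elim DefExt.semEquiv fun h => (DefExt.semEquiv h).symm)

theorem Mergeable.defEquiv {T T' : STheory P ar} (hT : Mergeable T T') : DefEquiv T T' := by
  obtain ⟨U, h, h'⟩ := hT
  exact Relation.ReflTransGen.head (b := U) (Or.inl h)
    (Relation.ReflTransGen.single (Or.inr h'))

theorem SemEquiv.mergeable {T T' : STheory P ar} (hdisj : Disjoint T.sig T'.sig)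
    (hT : SemEquiv T T') : Mergeable T T' := by
  obtain ⟨t, u, ht, hu, htu, hut⟩ := hT
  have hl : T.sig ⊆ T.sig ∪ T'.sig := Set.subset_union_left
  have hr : T'.sig ⊆ T.sig ∪ T'.sig := Set.subset_union_right
  let d (p : P) (hp : p ∈ T.sig ∪ T'.sig) (hn : p ∉ T.sig) :
      (Lang ar T.sig).Formula (Fin (ar p)) := u _ ⟨p, hp.resolve_left hn, rfl⟩
  let d' (p : P) (hp : p ∈ T.sig ∪ T'.sig) (hn : p ∉ T'.sig) :
      (Lang ar T'.sig).Formula (Fin (ar p)) := t _ ⟨p, hp.resolve_right hn, rfl⟩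
  let U : STheory P ar := ⟨T.sig ∪ T'.sig, (langIncl hl).onTheory T.th ∪
    {σ | ∃ (p : P) (hp : p ∈ T.sig ∪ T'.sig) (hn : p ∉ T.sig),
      σ = explicitDef hl hp (d p hp hn)}⟩
  refine ⟨U, ⟨hl, _, ⟨d, rfl⟩, fun _ _ _ => Iff.rfl⟩,
    defExt_iff.2 ⟨hr, d', fun M inst _ => (models_definitions hl d T.th inst).trans ?_⟩⟩
  have hd : (∀ (p : P) (hp : p ∈ T.sig ∪ T'.sig) (hn : p ∉ T.sig) (x : Fin (ar p) → M),
      (inst.RelMap (⟨p, hp, rfl⟩ : (Lang ar (T.sig ∪ T'.sig)).Relations (ar p)) x ↔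
        @Formula.Realize _ M (reductStruc hl inst) _ (d p hp hn) x)) ↔
      trStruc u M (reductStruc hl inst) = reductStruc hr inst := by
    constructor
    · intro H
      exact structure_ext fun p hp x =>
        (H p (hr hp) (hdisj.notMem_of_mem_right hp) x).symm
    · intro H p hp hn x
      exact iff_of_eq (congrArg (fun A : (Lang ar T'.sig).Structure M =>
        A.RelMap (⟨p, hp.resolve_left hn, rfl⟩ : (Lang ar T'.sig).Relations (ar p)) x) H.symm)
  have hd' : (∀ (p : P) (hp : p ∈ T.sig ∪ T'.sig) (hn : p ∉ T'.sig) (x : Fin (ar p) → M),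
      (inst.RelMap (⟨p, hp, rfl⟩ : (Lang ar (T.sig ∪ T'.sig)).Relations (ar p)) x ↔
        @Formula.Realize _ M (reductStruc hr inst) _ (d' p hp hn) x)) ↔
      trStruc t M (reductStruc hr inst) = reductStruc hl inst := by
    constructor
    · intro H
      exact structure_ext fun p hp x =>
        (H p (hl hp) (hdisj.notMem_of_mem_left hp) x).symm
    · intro H p hp hn x
      exact iff_of_eq (congrArg (fun A : (Lang ar T.sig).Structure M =>
        A.RelMap (⟨p, hp.resolve_right hn, rfl⟩ : (Lang ar T.sig).Relations (ar p)) x) H.symm)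
  refine (and_congr Iff.rfl hd).trans (Iff.trans ?_ (and_congr Iff.rfl hd').symm)
  constructor
  · rintro ⟨hM, e⟩
    rw [← e]
    exact ⟨hu M _ hM, htu M _ hM⟩
  · rintro ⟨hM, e⟩
    rw [← e]
    exact ⟨ht M _ hM, hut M _ hM⟩

end Semantics

/-- Theorem 6: for theories formulated in languages with disjoint signatures,
definitional equivalence, definitional mergeability and intertranslatability
coincide. -/
theorem disjoint_defEquiv_iff_mergeable_iff_intertranslatable {P : Type} {ar : P → ℕ}
    (T T' : STheory P ar) (hdisj : Disjoint T.sig T'.sig) :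
    (DefEquiv T T' ↔ Mergeable T T') ∧ (Mergeable T T' ↔ Intertranslatable T T') := by
  rw [intertranslatable_iff_semEquiv]
  exact ⟨⟨fun h => h.semEquiv.mergeable hdisj, Mergeable.defEquiv⟩,
    ⟨fun h => h.defEquiv.semEquiv, SemEquiv.mergeable hdisj⟩⟩

end DefEqPaper
end
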